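/- arXiv:1307.3084 — 2 statements merged into one kernel-verified Lean document; each statement's English description precedes it below -/
import Mathlib

section
/- Let p ∈ [0,1], let A be a finite subset of ℤ³ and let x ∈ A. Then for every integer k ≥ 1, P(T_A(x, ∂ⁱⁿA) ≥ k) ≤ (1 − θ(p))^k. -/
open MeasureTheory ENNReal

noncomputable section

/-- A site of the lattice `ℤ³`. -/
abbrev Site := Fin 3 → ℤ

/-- A percolation configuration: `ω z = true` means that the site `z` is open,
`ω z = false` means that it is closed. -/
abbrev Config := Site → Bool

/-- Two sites are neighbours when their Euclidean distance is `1`. -/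
def Adj (x y : Site) : Prop := ∑ i, |x i - y i| = 1

/-- `γ` is a path from `x` to `y` staying inside `A`. -/
def IsPathIn (A : Set Site) (x y : Site) (γ : List Site) : Prop :=
  γ.Chain' Adj ∧ γ.head? = some x ∧ γ.getLast? = some y ∧ ∀ z ∈ γ, z ∈ A

/-- The number of closed sites along the path `γ`. -/
def pathCost (ω : Config) (γ : List Site) : ℕ := γ.countP fun z => !ω z

/-- The travel time `T_A(x,y)` between `x` and `y` inside `A`: the infimum of the number
of closed sites over all paths from `x` to `y` in `A` (`⊤` if there is no such path). -/
def travelTime (ω : Config) (A : Set Site) (x y : Site) : ℝ≥0∞ :=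
  sInf {c : ℝ≥0∞ | ∃ γ : List Site, IsPathIn A x y γ ∧ c = pathCost ω γ}

/-- The travel time `T_A(x,E)` between `x` and the set `E` inside `A`. -/
def travelTimeSet (ω : Config) (A : Set Site) (x : Site) (E : Set Site) : ℝ≥0∞ :=
  ⨅ y ∈ E, travelTime ω A x y

/-- The open cluster `C(x)` of the site `x` (empty when `x` is closed). -/
def cluster (ω : Config) (x : Site) : Set Site :=
  {y | ∃ γ : List Site, IsPathIn {z | ω z = true} x y γ}

/-- The internal boundary `∂ⁱⁿA` of `A`. -/
def intBd (A : Set Site) : Set Site := {x | x ∈ A ∧ ∃ y ∉ A, Adj x y}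

/-- The external boundary `∂ᵒᵘᵗA` of `A`. -/
def extBd (A : Set Site) : Set Site := {x | x ∉ A ∧ ∃ y ∈ A, Adj x y}

/-- `P` is the Bernoulli site percolation measure with parameter `p`: the sites are
independent and each one is open with probability `p`, closed with probability `1 - p`,
as expressed by the probabilities of the cylinder events. -/
def IsBernoulli (p : ℝ) (P : Measure Config) : Prop :=
  ∀ (s : Finset Site) (f : Site → Bool),
    P {ω | ∀ z ∈ s, ω z = f z} =
      ∏ z ∈ s, (if f z then ENNReal.ofReal p else ENNReal.ofReal (1 - p))

/-- `θ(p)`: the probability that the open cluster of the origin is infinite. -/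
def theta (P : Measure Config) : ℝ≥0∞ := P {ω | (cluster ω 0).Infinite}

/-- The box `Λ(r) = [-r, r]³ ∩ ℤ³`. -/
def box (r : ℝ) : Set Site := {z | ∀ i, |(z i : ℝ)| ≤ r}


/-- Exploration: sites reachable by a path all of whose sites before the last are open. -/
inductive Explored (A : Set Site) (ω : Config) (x : Site) : Site → Prop
  | base : Explored A ω x x
  | step {u w : Site} : Explored A ω x u → ω u = true → Adj u w → w ∈ A → Explored A ω x w

/-- Cost of a single site. -/
def siteCost (ω : Config) (z : Site) : ℕ := if ω z = true then 0 else 1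

/-- `z` is reachable from `x` in `A` by a path of cost `n`. -/
inductive Reach (A : Set Site) (ω : Config) (x : Site) : ℕ → Site → Prop
  | base : Reach A ω x (siteCost ω x) x
  | step {n : ℕ} {u w : Site} : Reach A ω x n u → Adj u w → w ∈ A →
      Reach A ω x (n + siteCost ω w) w

/-- Open all the sites of `D`. -/
def openOn (D : Finset Site) (ω : Config) : Config := fun z => ω z || decide (z ∈ D)

lemma siteCost_le_one (ω : Config) (z : Site) : siteCost ω z ≤ 1 := by
  unfold siteCost; split_ifs <;> simp

lemma Explored.mem {A : Set Site} {ω : Config} {x z : Site} (hx : x ∈ A)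
    (h : Explored A ω x z) : z ∈ A := by
  cases h <;> assumption

lemma Explored.reach {A : Set Site} {ω : Config} {x z : Site}
    (h : Explored A ω x z) : Reach A ω x (siteCost ω z) z := by
  induction h with
  | base => exact Reach.base
  | @step u w hu ho ha hw ih =>
    have := Reach.step ih ha hw
    have h0 : siteCost ω u = 0 := by simp [siteCost, ho]
    rwa [h0, zero_add] at this

lemma Explored.congr {A : Set Site} {ω ω' : Config} {x : Site}
    (h : ∀ z, Explored A ω x z → ω z = ω' z) (z : Site) :
    Explored A ω x z ↔ Explored A ω' x z := by
  constructor
  · intro hz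
    induction hz with
    | base => exact Explored.base
    | step hu ho ha hw ih => exact Explored.step ih ((h _ hu).symm.trans ho) ha hw
  · intro hz
    induction hz with
    | base => exact Explored.base
    | step hu ho ha hw ih => exact Explored.step ih ((h _ ih).trans ho) ha hw

lemma Reach.congr {A : Set Site} {ω ω' : Config} {x : Site} (hx : x ∈ A)
    (h : ∀ z ∈ A, ω z = ω' z) {n : ℕ} {z : Site} (hr : Reach A ω x n z) :
    Reach A ω' x n z := by
  have hc : ∀ z ∈ A, siteCost ω z = siteCost ω' z := by
    intro z hz; simp [siteCost, h z hz]
  induction hr with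
  | base => rw [hc x hx]; exact Reach.base
  | step hu ha hw ih => rw [hc _ hw]; exact Reach.step ih ha hw

lemma Reach.transfer {A : Set Site} {ω : Config} {x : Site} {D D' : Finset Site}
    (hD : ∀ z, Explored A (openOn D ω) x z ↔ z ∈ D') {n : ℕ} {z : Site}
    (hr : Reach A (openOn D' ω) x n z) :
    ∃ m ≤ n + 1, Reach A (openOn D ω) x m z := by
  have key : ∀ z n, z ∈ D' → ∃ m ≤ n + 1, Reach A (openOn D ω) x m z := by
    intro z n hz
    exact ⟨_, (siteCost_le_one _ _).trans (by omega), ((hD z).2 hz).reach⟩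
  induction hr with
  | base => exact key _ _ ((hD x).1 Explored.base)
  | @step n u w hu ha hw ih =>
    by_cases hwD : w ∈ D'
    · exact key _ _ hwD
    · obtain ⟨m, hm, hr⟩ := ih
      refine ⟨_, ?_, Reach.step hr ha hw⟩
      have : siteCost (openOn D ω) w ≤ siteCost (openOn D' ω) w := by
        unfold siteCost openOn
        by_cases h : ω w = true <;> simp [h, hwD]
        split_ifs <;> simp
      omega

lemma Reach.path {A : Set Site} {ω : Config} {x : Site} (hx : x ∈ A) {n : ℕ} {z : Site}
    (hr : Reach A ω x n z) : ∃ γ, IsPathIn A x z γ ∧ pathCost ω γ = n := by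
  induction hr with
  | base =>
    refine ⟨[x], ⟨List.isChain_singleton _, by simp, by simp, by simpa using hx⟩, ?_⟩
    simp only [pathCost, siteCost]
    by_cases h : ω x = true <;> simp [h]
  | @step n u w hu ha hw ih =>
    obtain ⟨γ, ⟨h1, h2, h3, h4⟩, h5⟩ := ih
    refine ⟨γ ++ [w], ⟨?_, ?_, by simp, ?_⟩, ?_⟩
    · refine List.isChain_append.2 ⟨h1, List.isChain_singleton _, ?_⟩
      intro a ha' b hb
      rw [h3] at ha'
      simp only [Option.mem_def, Option.some.injEq, List.head?_cons] at ha' hb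
      subst ha' hb
      exact ha
    · simp [List.head?_append, h2]
    · intro z hz
      rcases List.mem_append.1 hz with hz | hz
      · exact h4 z hz
      · simp at hz; subst hz; exact hw
    · simp only [pathCost, siteCost, List.countP_append] at *
      rw [h5]
      by_cases h : ω w = true <;> simp [h]

/-- The exploration does not connect to the boundary. -/
def Blocked (A : Set Site) (x : Site) (ω : Config) : Prop :=
  ∀ z ∈ intBd A, Explored A ω x z → ω z = false

/-- Travel time at least `k`. -/
def Slow (A : Set Site) (x : Site) (k : ℕ) (ω : Config) : Prop :=
  ∀ n z, Reach A ω x n z → z ∈ intBd A → k ≤ n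

lemma slow_of_travel {A : Set Site} {x : Site} (hx : x ∈ A) {k : ℕ} {ω : Config}
    (h : (k : ℝ≥0∞) ≤ travelTimeSet ω A x (intBd A)) : Slow A x k ω := by
  intro n z hr hz
  obtain ⟨γ, h1, h2⟩ := hr.path hx
  have : travelTimeSet ω A x (intBd A) ≤ (n : ℝ≥0∞) := by
    refine (iInf₂_le z hz).trans (sInf_le ⟨γ, h1, by rw [h2]⟩)
  exact_mod_cast h.trans this

lemma Slow.blocked {A : Set Site} {x : Site} {k : ℕ} {ω : Config}
    (h : Slow A x (k + 1) ω) : Blocked A x ω := by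
  intro z hz he
  by_contra ho
  have := h _ _ he.reach hz
  rw [Bool.not_eq_false] at ho
  simp [siteCost, ho] at this

lemma exit_of_path {A : Set Site} {ω : Config} {x : Site} :
    ∀ (γ : List Site) (u y : Site), u ∈ A → Explored A ω x u →
      IsPathIn {z | ω z = true} u y γ → y ∉ A →
      ∃ z ∈ intBd A, Explored A ω x z ∧ ω z = true := by
  intro γ
  induction γ with
  | nil => intro u y _ _ h; simp [IsPathIn] at h
  | cons a l ih =>
    intro u y hu he h hy
    obtain ⟨h1, h2, h3, h4⟩ := h
    simp at h2
    subst h2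
    have hao : ω a = true := h4 a (by simp)
    cases l with
    | nil =>
      simp at h3
      subst h3
      exact absurd hu hy
    | cons b l =>
      have hab : Adj a b := (List.isChain_cons_cons.1 h1).1
      by_cases hb : b ∈ A
      · refine ih b y hb (Explored.step he hao hab hb) ⟨(List.isChain_cons_cons.1 h1).2, by simp,
          by simpa using h3, fun z hz => h4 z (List.mem_cons_of_mem _ hz)⟩ hy
      · exact ⟨a, ⟨hu, b, hb, hab⟩, he, hao⟩

lemma Explored.mono {A : Set Site} {ω ω' : Config} {x z : Site}
    (h : ∀ z, ω z = true → ω' z = true) (hz : Explored A ω x z) : Explored A ω' x z := by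
  induction hz with
  | base => exact Explored.base
  | step hu ho ha hw ih => exact Explored.step ih (h _ ho) ha hw

lemma not_blocked {A : Set Site} (hA : A.Finite) {x : Site} (hx : x ∈ A) (D : Finset Site)
    {ω : Config} (h : (cluster ω x).Infinite) : ¬ Blocked A x (openOn D ω) := by
  intro hb
  obtain ⟨y, hy, hyA⟩ := h.exists_notMem_finite hA
  obtain ⟨γ, hγ⟩ := hy
  obtain ⟨z, hz, he, ho⟩ := exit_of_path γ x y hx Explored.base hγ hyA
  have hm : ∀ z, ω z = true → openOn D ω z = true := by
    intro z hz; simp [openOn, hz]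
  have := hb z hz (he.mono hm)
  rw [hm z ho] at this
  exact absurd this (by simp)

/-! ### Measure theory -/

/-- The event `U` depends only on the sites of `s`. -/
def Dep (s : Finset Site) (U : Set Config) : Prop :=
  ∀ ω ω' : Config, (∀ z ∈ s, ω z = ω' z) → ω ∈ U → ω' ∈ U

lemma Dep.eq {s : Finset Site} {U : Set Config} (h : Dep s U) :
    U = s.restrict ⁻¹' (s.restrict '' U) := by
  apply Set.Subset.antisymm (Set.subset_preimage_image _ _)
  rintro ω ⟨ω', h', he⟩
  exact h ω' ω (fun z hz => congrFun he ⟨z, hz⟩) h'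

lemma Dep.measurableSet {s : Finset Site} {U : Set Config} (h : Dep s U) :
    MeasurableSet U := by
  rw [h.eq]
  exact (Finset.measurable_restrict s) (Set.toFinite _).measurableSet

/-- One-site marginal. -/
def nu (p : ℝ) : Measure Bool :=
  ENNReal.ofReal p • Measure.dirac true + ENNReal.ofReal (1 - p) • Measure.dirac false

lemma nu_singleton (p : ℝ) (b : Bool) :
    nu p {b} = if b then ENNReal.ofReal p else ENNReal.ofReal (1 - p) := by
  cases b <;> simp [nu]

lemma nu_prob {p : ℝ} (hp : p ∈ Set.Icc (0 : ℝ) 1) : IsProbabilityMeasure (nu p) := by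
  constructor
  simp only [nu, Measure.add_apply, Measure.smul_apply, measure_univ, smul_eq_mul, mul_one]
  rw [← ENNReal.ofReal_add hp.1 (by linarith [hp.2])]
  simp

lemma eq_infinitePi {p : ℝ} (hp : p ∈ Set.Icc (0 : ℝ) 1) (P : Measure Config)
    [IsProbabilityMeasure P] (hP : IsBernoulli p P) :
    haveI := nu_prob hp
    P = Measure.infinitePi (fun _ : Site => nu p) := by
  haveI := nu_prob hp
  refine IsProjectiveLimit.unique (P := fun I : Finset Site => Measure.pi fun _ : I => nu p) ?_
    (Measure.isProjectiveLimit_infinitePi _)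
  intro s
  apply Measure.ext_of_singleton
  intro g
  rw [Measure.map_apply (Finset.measurable_restrict s) (measurableSet_singleton g),
    Measure.pi_singleton]
  classical
  let f : Site → Bool := fun z => if h : z ∈ s then g ⟨z, h⟩ else true
  have h1 : (s.restrict : Config → (s → Bool)) ⁻¹' {g} = {ω : Config | ∀ z ∈ s, ω z = f z} := by
    ext ω
    simp only [Set.mem_preimage, Set.mem_singleton_iff, Set.mem_setOf_eq, funext_iff, f]
    constructor
    · intro h z hz; simpa [hz] using h ⟨z, hz⟩
    · rintro h ⟨z, hz⟩; simpa [hz] using h z hz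
  refine (congrArg P h1).trans ?_
  rw [hP s f, ← Finset.prod_coe_sort]
  refine Finset.prod_congr rfl fun z _ => ?_
  rw [nu_singleton]
  simp [f]

lemma indep {p : ℝ} (hp : p ∈ Set.Icc (0 : ℝ) 1) (P : Measure Config)
    [IsProbabilityMeasure P] (hP : IsBernoulli p P) {s t : Finset Site} (hst : Disjoint s t)
    {U V : Set Config} (hU : Dep s U) (hV : Dep t V) : P (U ∩ V) = P U * P V := by
  haveI := nu_prob hp
  have h := ProbabilityTheory.iIndepFun_infinitePi (P := fun _ : Site => nu p)
    (X := fun _ b => b) (fun _ => measurable_id)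
  rw [← eq_infinitePi hp P hP] at h
  have h2 := h.indepFun_finset s t hst (fun i => measurable_pi_apply i)
  have h3 := (ProbabilityTheory.indepFun_iff_measure_inter_preimage_eq_mul.1 h2)
    (s.restrict '' U) (t.restrict '' V) (Set.toFinite _).measurableSet
    (Set.toFinite _).measurableSet
  change P (s.restrict ⁻¹' (s.restrict '' U) ∩ t.restrict ⁻¹' (t.restrict '' V)) =
    P (s.restrict ⁻¹' (s.restrict '' U)) * P (t.restrict ⁻¹' (t.restrict '' V)) at h3
  rwa [← hU.eq, ← hV.eq] at h3

/-- Translation of configurations. -/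
def shift (x : Site) : Config ≃ᵐ Config where
  toFun ω := fun z => ω (z + x)
  invFun ω := fun z => ω (z - x)
  left_inv ω := by ext z; simp
  right_inv ω := by ext z; simp
  measurable_toFun := measurable_pi_lambda _ fun z => measurable_pi_apply _
  measurable_invFun := measurable_pi_lambda _ fun z => measurable_pi_apply _

lemma map_shift {p : ℝ} (hp : p ∈ Set.Icc (0 : ℝ) 1) (P : Measure Config)
    [IsProbabilityMeasure P] (hP : IsBernoulli p P) (x : Site) : P.map (shift x) = P := by
  haveI : IsProbabilityMeasure (P.map (shift x)) :=
    Measure.isProbabilityMeasure_map (shift x).measurable.aemeasurable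
  have h : IsBernoulli p (P.map (shift x)) := by
    intro s f
    rw [MeasurableEquiv.map_apply]
    have h1 : (shift x) ⁻¹' {ω : Config | ∀ z ∈ s, ω z = f z} =
        {ω : Config | ∀ z ∈ s.map (addRightEmbedding x), ω z = f (z - x)} := by
      ext ω
      simp [shift]
    rw [h1, hP _ (fun z => f (z - x)), Finset.prod_map]
    simp
  rw [eq_infinitePi hp _ h]
  exact (eq_infinitePi hp P hP).symm

lemma cluster_shift (x : Site) (ω : Config) (h : (cluster (shift x ω) 0).Infinite) :
    (cluster ω x).Infinite := by
  refine (h.image ((add_left_injective x).injOn)).mono ?_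
  rintro _ ⟨y, ⟨γ, h1, h2, h3, h4⟩, rfl⟩
  refine ⟨γ.map (· + x), ?_, ?_, ?_, ?_⟩
  · refine (List.isChain_map _).2 (h1.imp ?_)
    intro a b hab
    simpa [Adj] using hab
  · simp [h2]
  · simp [h3]
  · intro z hz
    obtain ⟨w, hw, rfl⟩ := List.mem_map.1 hz
    exact h4 w hw

lemma theta_le {p : ℝ} (hp : p ∈ Set.Icc (0 : ℝ) 1) (P : Measure Config)
    [IsProbabilityMeasure P] (hP : IsBernoulli p P) (x : Site) :
    theta P ≤ P {ω | (cluster ω x).Infinite} := by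
  unfold theta
  conv_lhs => rw [← map_shift hp P hP x]
  rw [MeasurableEquiv.map_apply]
  exact measure_mono fun ω h => cluster_shift x ω h

lemma dep_blocked {A : Set Site} {B : Finset Site} (hB : ∀ z, z ∈ B ↔ z ∈ A) {x : Site}
    (hx : x ∈ A) (D : Finset Site) : Dep B {ω | Blocked A x (openOn D ω)} := by
  intro ω ω' h hb z hz he
  have hag : ∀ z, Explored A (openOn D ω) x z → openOn D ω z = openOn D ω' z := by
    intro z hz
    simp [openOn, h z ((hB z).2 (hz.mem hx))]
  have he' := (Explored.congr hag z).2 he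
  rw [← hag z he']
  exact hb z hz he'

lemma blocked_le {p : ℝ} (hp : p ∈ Set.Icc (0 : ℝ) 1) (P : Measure Config)
    [IsProbabilityMeasure P] (hP : IsBernoulli p P) {A : Set Site} (hA : A.Finite)
    {x : Site} (hx : x ∈ A) (D : Finset Site) :
    P {ω | Blocked A x (openOn D ω)} ≤ 1 - theta P := by
  have hm : MeasurableSet {ω | Blocked A x (openOn D ω)} :=
    (dep_blocked (B := hA.toFinset) (by simp) hx D).measurableSet
  have h1 : theta P ≤ P {ω | Blocked A x (openOn D ω)}ᶜ :=
    (theta_le hp P hP x).trans (measure_mono fun ω h => not_blocked hA hx D h)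
  have h2 := prob_add_prob_compl (μ := P) hm
  refine ENNReal.le_sub_of_add_le_right (ne_top_of_le_ne_top (measure_ne_top _ _) h1) ?_
  rw [← h2]
  gcongr

/-- The event that the exploration (with `D` opened) yields `D'` and is blocked. -/
def stepEvent (A : Set Site) (x : Site) (D D' : Finset Site) : Set Config :=
  {ω | (∀ z, Explored A (openOn D ω) x z ↔ z ∈ D') ∧ Blocked A x (openOn D ω)}

lemma dep_stepEvent (A : Set Site) (x : Site) (D D' : Finset Site) :
    Dep D' (stepEvent A x D D') := by
  rintro ω ω' h ⟨h1, h2⟩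
  have hag : ∀ z, Explored A (openOn D ω) x z → openOn D ω z = openOn D ω' z := by
    intro z hz
    simp [openOn, h z ((h1 z).1 hz)]
  refine ⟨fun z => (Explored.congr hag z).symm.trans (h1 z), fun z hz he => ?_⟩
  have he' := (Explored.congr hag z).2 he
  rw [← hag z he']
  exact h2 z hz he'

lemma dep_slow {A : Set Site} {B : Finset Site} (hB : ∀ z, z ∈ B ↔ z ∈ A) {x : Site}
    (hx : x ∈ A) (k : ℕ) (D : Finset Site) : Dep (B \ D) {ω | Slow A x k (openOn D ω)} := by
  intro ω ω' h hs n z hr hz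
  refine hs n z (hr.congr hx ?_) hz
  intro z hz
  by_cases hD : z ∈ D
  · simp [openOn, hD]
  · simp [openOn, hD, h z (by simp [hD, hB, hz])]

lemma slow_le {p : ℝ} (hp : p ∈ Set.Icc (0 : ℝ) 1) (P : Measure Config)
    [IsProbabilityMeasure P] (hP : IsBernoulli p P) {A : Set Site} (hA : A.Finite)
    {x : Site} (hx : x ∈ A) (k : ℕ) : ∀ D : Finset Site,
    P {ω | Slow A x k (openOn D ω)} ≤ (1 - theta P) ^ k := by
  induction k with
  | zero => intro D; simpa using prob_le_one
  | succ k ih =>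
    intro D
    classical
    set B := hA.toFinset with hBdef
    have hB : ∀ z, z ∈ B ↔ z ∈ A := by simp [hBdef]
    have hsub : {ω | Slow A x (k + 1) (openOn D ω)} ⊆
        ⋃ D' ∈ B.powerset, stepEvent A x D D' ∩ {ω | Slow A x k (openOn D' ω)} := by
      intro ω hω
      let D' := B.filter fun z => Explored A (openOn D ω) x z
      have hD' : ∀ z, Explored A (openOn D ω) x z ↔ z ∈ D' := by
        intro z
        simp only [D', Finset.mem_filter, hB]
        exact ⟨fun h => ⟨h.mem hx, h⟩, fun h => h.2⟩
      refine Set.mem_iUnion₂.2 ⟨D', by simp [D'], ⟨hD', Slow.blocked hω⟩, ?_⟩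
      intro n z hr hz
      obtain ⟨m, hm, hr'⟩ := hr.transfer hD'
      have := hω m z hr' hz
      omega
    have hdisj : (B.powerset : Set (Finset Site)).PairwiseDisjoint (stepEvent A x D) := by
      intro D1 _ D2 _ hne
      refine Set.disjoint_left.2 fun ω h1 h2 => hne ?_
      ext z
      exact (h1.1 z).symm.trans (h2.1 z)
    calc P {ω | Slow A x (k + 1) (openOn D ω)}
        ≤ ∑ D' ∈ B.powerset, P (stepEvent A x D D' ∩ {ω | Slow A x k (openOn D' ω)}) :=
          (measure_mono hsub).trans (measure_biUnion_finset_le _ _)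
      _ = ∑ D' ∈ B.powerset, P (stepEvent A x D D') * P {ω | Slow A x k (openOn D' ω)} :=
          Finset.sum_congr rfl fun D' _ => indep hp P hP Finset.disjoint_sdiff
            (dep_stepEvent A x D D') (dep_slow hB hx k D')
      _ ≤ ∑ D' ∈ B.powerset, P (stepEvent A x D D') * (1 - theta P) ^ k :=
          Finset.sum_le_sum fun D' _ => by gcongr; exact ih D'
      _ = P (⋃ D' ∈ B.powerset, stepEvent A x D D') * (1 - theta P) ^ k := by
          rw [← Finset.sum_mul, measure_biUnion_finset hdisj
            fun D' _ => (dep_stepEvent A x D D').measurableSet]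
      _ ≤ (1 - theta P) * (1 - theta P) ^ k := by
          gcongr
          refine (measure_mono ?_).trans (blocked_le hp P hP hA hx D)
          exact Set.iUnion₂_subset fun D' _ ω h => h.2
      _ = (1 - theta P) ^ (k + 1) := by rw [pow_succ, mul_comm]

/-- **Lemma (BK bound).**  For a finite `A ⊆ ℤ³`, `x ∈ A` and `k ≥ 1`,
`P(T_A(x, ∂ⁱⁿA) ≥ k) ≤ (1 - θ(p))^k`. -/
theorem stmt_1 (p : ℝ) (hp : p ∈ Set.Icc (0 : ℝ) 1)
    (P : Measure Config) [IsProbabilityMeasure P] (hP : IsBernoulli p P)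
    (A : Set Site) (hA : A.Finite) (x : Site) (hx : x ∈ A) (k : ℕ) (hk : 1 ≤ k) :
    P {ω | (k : ℝ≥0∞) ≤ travelTimeSet ω A x (intBd A)} ≤ (1 - theta P) ^ k := by
  refine (measure_mono fun ω hω => ?_).trans (slow_le hp P hP hA hx k ∅)
  have h := slow_of_travel hx hω
  have he : openOn ∅ ω = ω := by ext z; simp [openOn]
  change Slow A x k (openOn ∅ ω)
  rwa [he]
end
end

section
/- Let p ∈ [0,1] satisfy θ(p) > 0, let n ≥ 1 and let Λ = Λ(n). For every integer k ≥ 1, P(T_Λ(0, F_1^1) ≥ k) ≤ (1 − θ(p))^{k/24}. -/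
open MeasureTheory ENNReal

noncomputable section

/-- The two coordinates other than `d`. -/
def others : Fin 3 → Fin 3 × Fin 3 := ![(1, 2), (0, 2), (0, 1)]

/-- The square `F_i^j` of the box `x + Λ(m)` (before translation by `x`): the face of the
cube `Λ(m)` in direction `(d, ε)`, restricted to the quadrant given by the signs `s₁, s₂`
on the two other coordinates.  Each such square shares a vertex with a vertex of the cube
and admits the center of the face as another vertex. -/
def faceSq (m : ℕ) (d : Fin 3) (ε s₁ s₂ : Bool) : Set Site :=
  {z | z ∈ box m ∧ z d = (if ε then (m : ℤ) else -(m : ℤ)) ∧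
    (if s₁ then 0 ≤ z (others d).1 else z (others d).1 ≤ 0) ∧
    (if s₂ then 0 ≤ z (others d).2 else z (others d).2 ≤ 0)}

/-! ### Finite expectations -/

/-- Indicator of a proposition. -/
def ind (A : Prop) : ℝ := open Classical in if A then 1 else 0

lemma ind_nonneg (A : Prop) : 0 ≤ ind A := by
  unfold ind; split_ifs <;> norm_num

lemma ind_le_one (A : Prop) : ind A ≤ 1 := by
  unfold ind; split_ifs <;> norm_num

lemma ind_mono {A B : Prop} (h : A → B) : ind A ≤ ind B := by
  unfold ind; split_ifs <;> first | (exfalso; tauto) | norm_num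

lemma ind_true {A : Prop} (h : A) : ind A = 1 := by simp [ind, h]

lemma ind_false {A : Prop} (h : ¬ A) : ind A = 0 := by simp [ind, h]

/-- weight of the open set `t` inside `U`. -/
def wt (p : ℝ) (U t : Finset Site) : ℝ := ∏ z ∈ U, if z ∈ t then p else 1 - p

/-- Expectation on the finite set `U`. -/
def EE (p : ℝ) (U : Finset Site) (f : Finset Site → ℝ) : ℝ :=
  ∑ t ∈ U.powerset, wt p U t * f t

lemma wt_nonneg {p : ℝ} (hp : p ∈ Set.Icc (0 : ℝ) 1) (U t : Finset Site) : 0 ≤ wt p U t := by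
  apply Finset.prod_nonneg
  intro z _
  split_ifs
  · exact hp.1
  · linarith [hp.2]

lemma EE_empty (p : ℝ) (f : Finset Site → ℝ) : EE p ∅ f = f ∅ := by
  simp [EE, wt]

lemma EE_insert (p : ℝ) (U : Finset Site) (s : Site) (hs : s ∉ U) (f : Finset Site → ℝ) :
    EE p (insert s U) f = (1 - p) * EE p U f + p * EE p U (fun t => f (insert s t)) := by
  unfold EE
  rw [Finset.sum_powerset_insert hs, Finset.mul_sum, Finset.mul_sum]
  congr 1
  · apply Finset.sum_congr rfl
    intro t ht
    have : s ∉ t := fun h => hs (Finset.mem_powerset.1 ht h)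
    unfold wt
    rw [Finset.prod_insert hs, if_neg this]; ring
  · apply Finset.sum_congr rfl
    intro t ht
    have hst : s ∉ t := fun h => hs (Finset.mem_powerset.1 ht h)
    unfold wt
    rw [Finset.prod_insert hs, if_pos (Finset.mem_insert_self _ _)]
    have : ∏ x ∈ U, (if x ∈ insert s t then p else 1 - p)
        = ∏ x ∈ U, (if x ∈ t then p else 1 - p) := by
      apply Finset.prod_congr rfl
      intro x hx
      have : x ≠ s := fun h => hs (h ▸ hx)
      simp [this]
    rw [this]; ring

lemma EE_mono {p : ℝ} (hp : p ∈ Set.Icc (0 : ℝ) 1) (U : Finset Site) {f g : Finset Site → ℝ}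
    (h : ∀ t ⊆ U, f t ≤ g t) : EE p U f ≤ EE p U g := by
  apply Finset.sum_le_sum
  intro t ht
  exact mul_le_mul_of_nonneg_left (h t (Finset.mem_powerset.1 ht)) (wt_nonneg hp _ _)

lemma EE_const (p : ℝ) (U : Finset Site) (c : ℝ) : EE p U (fun _ => c) = c := by
  induction U using Finset.induction_on with
  | empty => simp [EE_empty]
  | insert s U hs ih => rw [EE_insert p U s hs, ih]; ring

lemma EE_nonneg {p : ℝ} (hp : p ∈ Set.Icc (0 : ℝ) 1) (U : Finset Site) {f : Finset Site → ℝ}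
    (h : ∀ t, 0 ≤ f t) : 0 ≤ EE p U f := by
  apply Finset.sum_nonneg
  intro t ht
  exact mul_nonneg (wt_nonneg hp _ _) (h t)

/-- Harris inequality. -/
lemma harris {p : ℝ} (hp : p ∈ Set.Icc (0 : ℝ) 1) (U : Finset Site) (f g : Finset Site → ℝ)
    (hf : Antitone f) (hg : Antitone g) :
    EE p U f * EE p U g ≤ EE p U (fun t => f t * g t) := by
  induction U using Finset.induction_on generalizing f g with
  | empty => simp [EE_empty]
  | insert s U hs ih =>
    rw [EE_insert p U s hs, EE_insert p U s hs, EE_insert p U s hs]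
    have hi : Monotone (fun t : Finset Site => insert s t) :=
      fun a b hab => Finset.insert_subset_insert s hab
    have h0 := ih f g hf hg
    have h1 := ih (fun t => f (insert s t)) (fun t => g (insert s t))
      (hf.comp_monotone hi) (hg.comp_monotone hi)
    have hF : EE p U (fun t => f (insert s t)) ≤ EE p U f :=
      EE_mono hp U fun t _ => hf (Finset.subset_insert s t)
    have hG : EE p U (fun t => g (insert s t)) ≤ EE p U g :=
      EE_mono hp U fun t _ => hg (Finset.subset_insert s t)
    have hp0 := hp.1
    have hp1 : 0 ≤ 1 - p := by linarith [hp.2]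
    have a0 := mul_le_mul_of_nonneg_left h0 hp1
    have a1 := mul_le_mul_of_nonneg_left h1 hp0
    have a2 := mul_nonneg (mul_nonneg hp0 hp1) (mul_nonneg (sub_nonneg.2 hF) (sub_nonneg.2 hG))
    refine le_trans ?_ (add_le_add a0 a1)
    nlinarith [a2]

lemma harris_prod {p : ℝ} (hp : p ∈ Set.Icc (0 : ℝ) 1) (U : Finset Site) {ι : Type*}
    (I : Finset ι) (f : ι → Finset Site → ℝ) (hf : ∀ i, Antitone (f i))
    (hf0 : ∀ i t, 0 ≤ f i t) :
    ∏ i ∈ I, EE p U (f i) ≤ EE p U (fun t => ∏ i ∈ I, f i t) := by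
  classical
  induction I using Finset.induction_on with
  | empty => simp [EE_const]
  | insert a I ha ih =>
    simp only [Finset.prod_insert ha]
    refine le_trans (mul_le_mul_of_nonneg_left ih (EE_nonneg hp U (hf0 a))) ?_
    apply harris hp U _ _ (hf a)
    intro t t' htt'
    exact Finset.prod_le_prod (fun i _ => hf0 i t') (fun i _ => hf i htt')

/-- Union bound linking `P` with the finite expectation. -/
lemma P_le_EE {p : ℝ} (hp : p ∈ Set.Icc (0 : ℝ) 1) (P : Measure Config) (hP : IsBernoulli p P)
    (U : Finset Site) (A : Finset Site → Prop) :
    P {ω | A (U.filter fun z => ω z = true)} ≤ ENNReal.ofReal (EE p U fun t => ind (A t)) := by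
  classical
  have hsub : {ω : Config | A (U.filter fun z => ω z = true)} ⊆
      ⋃ t ∈ U.powerset.filter A, {ω : Config | ∀ z ∈ U, ω z = decide (z ∈ t)} := by
    intro ω hω
    simp only [Set.mem_iUnion]
    refine ⟨U.filter fun z => ω z = true, ?_, ?_⟩
    · simp only [Finset.mem_filter, Finset.mem_powerset]
      exact ⟨Finset.filter_subset _ _, hω⟩
    · intro z hz
      simp [hz]
  refine (measure_mono hsub).trans ((measure_biUnion_finset_le _ _).trans ?_)
  unfold EE
  rw [ENNReal.ofReal_sum_of_nonneg
    (fun t _ => mul_nonneg (wt_nonneg hp _ _) (ind_nonneg _)), Finset.sum_filter]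
  apply Finset.sum_le_sum
  intro t _
  split_ifs with h
  · rw [hP U (fun z => decide (z ∈ t)), ind_true h, mul_one]
    unfold wt
    rw [ENNReal.ofReal_prod_of_nonneg]
    · apply le_of_eq
      apply Finset.prod_congr rfl
      intro z _
      by_cases hz : z ∈ t <;> simp [hz]
    · intro z _
      split_ifs
      · exact hp.1
      · linarith [hp.2]
  · exact zero_le

/-! ### Reachability -/

/-- `RR t U H j z`: `z` can be reached inside `U` from the sources `H` (with initial costs)
with cost at most `j`, when the set of open sites is `t`. -/
inductive RR (t U : Finset Site) (H : ℕ → Site → Prop) : ℕ → Site → Prop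
  | src_free (j : ℕ) (s : Site) : s ∈ U → s ∈ t → H j s → RR t U H j s
  | src_pay (j : ℕ) (s : Site) : s ∈ U → H j s → RR t U H (j + 1) s
  | free (j : ℕ) (y s : Site) : s ∈ U → s ∈ t → Adj y s → RR t U H j y → RR t U H j s
  | pay (j : ℕ) (y s : Site) : s ∈ U → Adj y s → RR t U H j y → RR t U H (j + 1) s

lemma RR.mem {t U H j z} (h : RR t U H j z) : z ∈ U := by
  cases h <;> assumption

lemma RR.mono {t t' U H H' c j z} (htt : t ⊆ t')
    (hH : ∀ j, ∀ s ∈ U, H j s → H' (j + c) s) (h : RR t U H j z) : RR t' U H' (j + c) z := by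
  induction h with
  | src_free j s hU ht h => exact .src_free _ _ hU (htt ht) (hH _ _ hU h)
  | src_pay j s hU h =>
    rw [add_right_comm]; exact .src_pay _ _ hU (hH _ _ hU h)
  | free j y s hU ht ha _ ih => exact .free _ y _ hU (htt ht) ha ih
  | pay j y s hU ha _ ih =>
    rw [add_right_comm]; exact .pay _ y _ hU ha ih

/-- The target set is hit with cost `< k`. -/
def Hit (t U : Finset Site) (H : ℕ → Site → Prop) (D : Set Site) (k : ℕ) : Prop :=
  ∃ j < k, ∃ z ∈ D, RR t U H j z

/-- Sources `S` at level zero and `S'` at level one. -/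
def src (S S' : Set Site) (j : ℕ) (s : Site) : Prop := (j = 0 ∧ s ∈ S) ∨ (j = 1 ∧ s ∈ S')

/-- neighbours -/
def nb (s : Site) : Set Site := {y | Adj s y}

lemma RR_open {t U : Finset Site} {s : Site} {S S' : Set Site} {j z} (hs : s ∈ S)
    (h : RR t U (src (S ∪ nb s) S') j z) : RR (insert s t) (insert s U) (src S S') j z := by
  have key : RR (insert s t) (insert s U) (src S S') 0 s :=
    .src_free 0 s (Finset.mem_insert_self _ _) (Finset.mem_insert_self _ _) (Or.inl ⟨rfl, hs⟩)
  induction h with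
  | src_free j x hU ht h =>
    rcases h with ⟨rfl, h | h⟩ | ⟨rfl, h⟩
    · exact .src_free _ _ (Finset.mem_insert_of_mem hU) (Finset.mem_insert_of_mem ht)
        (Or.inl ⟨rfl, h⟩)
    · exact .free _ s _ (Finset.mem_insert_of_mem hU) (Finset.mem_insert_of_mem ht) h key
    · exact .src_free _ _ (Finset.mem_insert_of_mem hU) (Finset.mem_insert_of_mem ht)
        (Or.inr ⟨rfl, h⟩)
  | src_pay j x hU h =>
    rcases h with ⟨rfl, h | h⟩ | ⟨rfl, h⟩
    · exact .src_pay _ _ (Finset.mem_insert_of_mem hU) (Or.inl ⟨rfl, h⟩)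
    · exact .pay _ s _ (Finset.mem_insert_of_mem hU) h key
    · exact .src_pay _ _ (Finset.mem_insert_of_mem hU) (Or.inr ⟨rfl, h⟩)
  | free j y x hU ht ha _ ih =>
    exact .free _ y _ (Finset.mem_insert_of_mem hU) (Finset.mem_insert_of_mem ht) ha ih
  | pay j y x hU ha _ ih =>
    exact .pay _ y _ (Finset.mem_insert_of_mem hU) ha ih

lemma RR_closed {t U : Finset Site} {s : Site} {S S' : Set Site} {j z} (hs : s ∈ S)
    (h : RR t U (src S (S' ∪ nb s)) j z) : RR t (insert s U) (src S S') j z := by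
  have key : RR t (insert s U) (src S S') 1 s :=
    .src_pay 0 s (Finset.mem_insert_self _ _) (Or.inl ⟨rfl, hs⟩)
  induction h with
  | src_free j x hU ht h =>
    rcases h with ⟨rfl, h⟩ | ⟨rfl, h | h⟩
    · exact .src_free _ _ (Finset.mem_insert_of_mem hU) ht (Or.inl ⟨rfl, h⟩)
    · exact .src_free _ _ (Finset.mem_insert_of_mem hU) ht (Or.inr ⟨rfl, h⟩)
    · exact .free _ s _ (Finset.mem_insert_of_mem hU) ht h key
  | src_pay j x hU h =>
    rcases h with ⟨rfl, h⟩ | ⟨rfl, h | h⟩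
    · exact .src_pay _ _ (Finset.mem_insert_of_mem hU) (Or.inl ⟨rfl, h⟩)
    · exact .src_pay _ _ (Finset.mem_insert_of_mem hU) (Or.inr ⟨rfl, h⟩)
    · exact .pay _ s _ (Finset.mem_insert_of_mem hU) h key
  | free j y x hU ht ha _ ih =>
    exact .free _ y _ (Finset.mem_insert_of_mem hU) ht ha ih
  | pay j y x hU ha _ ih =>
    exact .pay _ y _ (Finset.mem_insert_of_mem hU) ha ih

lemma RR_open_inv {t U : Finset Site} {s : Site} {S : Set Site} {j z}
    (h : RR (insert s t) (insert s U) (src S ∅) j z) (hj : j = 0) :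
    z = s ∨ RR t U (src (S ∪ nb s) ∅) 0 z := by
  induction h with
  | src_free j x hU ht h =>
    subst hj
    by_cases hx : x = s
    · exact Or.inl hx
    · right
      rcases h with ⟨_, h⟩ | ⟨h, _⟩
      · exact .src_free _ _ (Finset.mem_of_mem_insert_of_ne hU hx)
          (Finset.mem_of_mem_insert_of_ne ht hx) (Or.inl ⟨rfl, Or.inl h⟩)
      · omega
  | src_pay j x hU h => omega
  | free j y x hU ht ha _ ih =>
    by_cases hx : x = s
    · exact Or.inl hx
    · right
      rcases ih hj with rfl | h
      · exact .src_free _ _ (Finset.mem_of_mem_insert_of_ne hU hx)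
          (Finset.mem_of_mem_insert_of_ne ht hx) (Or.inl ⟨rfl, Or.inr ha⟩)
      · exact .free _ y _ (Finset.mem_of_mem_insert_of_ne hU hx)
          (Finset.mem_of_mem_insert_of_ne ht hx) ha h
  | pay j y x hU ha _ ih => omega

lemma RR_closed_inv {t U : Finset Site} {s : Site} {S : Set Site} {j z} (hst : s ∉ t)
    (h : RR t (insert s U) (src S ∅) j z) (hj : j = 0) :
    RR t U (src S ∅) 0 z := by
  induction h with
  | src_free j x hU ht h =>
    subst hj
    have hx : x ≠ s := fun h => hst (h ▸ ht)
    exact .src_free _ _ (Finset.mem_of_mem_insert_of_ne hU hx) ht h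
  | src_pay j x hU h => omega
  | free j y x hU ht ha _ ih =>
    have hx : x ≠ s := fun h => hst (h ▸ ht)
    exact .free _ y _ (Finset.mem_of_mem_insert_of_ne hU hx) ht ha (ih hj)
  | pay j y x hU ha _ ih => omega

/-- Probability that `D` is not hit with cost less than `k`. -/
def FF (p : ℝ) (D : Set Site) (k : ℕ) (U : Finset Site) (S S' : Set Site) : ℝ :=
  EE p U fun t => ind (¬ Hit t U (src S S') D k)

lemma FF_shift {p : ℝ} (hp : p ∈ Set.Icc (0 : ℝ) 1) (D : Set Site) (k c : ℕ) (U : Finset Site)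
    (S S' S1 S1' : Set Site)
    (h : ∀ j, ∀ s ∈ U, src S1 S1' j s → src S S' (j + c) s) :
    FF p D (k + c) U S S' ≤ FF p D k U S1 S1' := by
  apply EE_mono hp
  intro t _
  apply ind_mono
  rintro hn ⟨j, hj, z, hz, hR⟩
  exact hn ⟨j + c, by omega, z, hz, hR.mono subset_rfl h⟩

lemma GG_antitone {p : ℝ} (hp : p ∈ Set.Icc (0 : ℝ) 1) (D : Set Site) (U : Finset Site)
    (S S1 : Set Site) (h : ∀ s ∈ U, s ∈ S1 → s ∈ S) : FF p D 1 U S ∅ ≤ FF p D 1 U S1 ∅ := by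
  apply FF_shift hp D 1 0
  rintro j s hs (⟨rfl, h1⟩ | ⟨rfl, h1⟩)
  · exact Or.inl ⟨rfl, h s hs h1⟩
  · exact h1.elim

/-- one-step decomposition for the connection event -/
lemma GG_step {p : ℝ} (hp : p ∈ Set.Icc (0 : ℝ) 1) (D : Set Site) (U : Finset Site) (s : Site)
    (hsU : s ∉ U) (hsD : s ∉ D) (S : Set Site) :
    (1 - p) * FF p D 1 U S ∅ + p * FF p D 1 U (S ∪ nb s) ∅ ≤ FF p D 1 (insert s U) S ∅ := by
  unfold FF
  rw [EE_insert p U s hsU]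
  apply add_le_add
  · apply mul_le_mul_of_nonneg_left _ (by linarith [hp.2])
    apply EE_mono hp
    intro t ht
    apply ind_mono
    rintro hn ⟨j, hj, z, hz, hR⟩
    exact hn ⟨0, by omega, z, hz, RR_closed_inv (fun h => hsU (ht h)) hR (by omega)⟩
  · apply mul_le_mul_of_nonneg_left _ hp.1
    apply EE_mono hp
    intro t ht
    apply ind_mono
    rintro hn ⟨j, hj, z, hz, hR⟩
    rcases RR_open_inv hR (by omega) with rfl | h
    · exact hsD hz
    · exact hn ⟨0, by omega, z, hz, h⟩

lemma FF_step {p : ℝ} (hp : p ∈ Set.Icc (0 : ℝ) 1) (D : Set Site) (U : Finset Site) (s : Site)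
    (hsU : s ∉ U) (S S' : Set Site) (hs : s ∈ S) (k : ℕ) :
    FF p D k (insert s U) S S' ≤
      (1 - p) * FF p D k U S (S' ∪ nb s) + p * FF p D k U (S ∪ nb s) S' := by
  unfold FF
  rw [EE_insert p U s hsU]
  apply add_le_add
  · apply mul_le_mul_of_nonneg_left _ (by linarith [hp.2])
    apply EE_mono hp
    intro t ht
    apply ind_mono
    rintro hn ⟨j, hj, z, hz, hR⟩
    exact hn ⟨j, hj, z, hz, RR_closed hs hR⟩
  · apply mul_le_mul_of_nonneg_left _ hp.1
    apply EE_mono hp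
    intro t ht
    apply ind_mono
    rintro hn ⟨j, hj, z, hz, hR⟩
    exact hn ⟨j, hj, z, hz, RR_open hs hR⟩

lemma FF_nonneg {p : ℝ} (hp : p ∈ Set.Icc (0 : ℝ) 1) (D : Set Site) (k : ℕ) (U : Finset Site)
    (S S' : Set Site) : 0 ≤ FF p D k U S S' := EE_nonneg hp U fun _ => ind_nonneg _

lemma explore {p : ℝ} (hp : p ∈ Set.Icc (0 : ℝ) 1) (D : Set Site) (q : ℝ) (hq : 0 ≤ q) (k : ℕ) :
    ∀ (m : ℕ) (U : Finset Site), U.card = m → ∀ S S' : Set Site,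
      FF p D 1 U (S ∪ S') ∅ ≤ q → FF p D (k + 1) U S S' ≤ q ^ k * FF p D 1 U S ∅ := by
  classical
  induction k with
  | zero =>
    intro m U _ S S' _
    rw [pow_zero, one_mul]
    apply FF_shift hp D 1 0
    rintro j s hs (⟨rfl, h1⟩ | ⟨rfl, h1⟩)
    · exact Or.inl ⟨rfl, h1⟩
    · exact h1.elim
  | succ k ihk =>
    intro m
    induction m with
    | zero =>
      intro U hU S S' hinv
      obtain rfl := Finset.card_eq_zero.1 hU
      have h1 : FF p D 1 ∅ S ∅ = 1 := by
        unfold FF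
        rw [EE_empty]
        apply ind_true
        rintro ⟨j, hj, z, hz, hR⟩
        exact absurd hR.mem (Finset.notMem_empty _)
      have h2 : FF p D 1 ∅ (S ∪ S') ∅ = 1 := by
        unfold FF
        rw [EE_empty]
        apply ind_true
        rintro ⟨j, hj, z, hz, hR⟩
        exact absurd hR.mem (Finset.notMem_empty _)
      rw [h1, mul_one]
      rw [h2] at hinv
      refine le_trans ?_ (one_le_pow₀ hinv)
      unfold FF
      rw [EE_empty]
      exact ind_le_one _
    | succ m ihm =>
      intro U hU S S' hinv
      by_cases hS : ∃ s ∈ U, s ∈ S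
      · obtain ⟨s, hsU, hsS⟩ := hS
        by_cases hsD : s ∈ D
        · have : FF p D (k + 1 + 1) U S S' = 0 := by
            have h0 : ∀ t, ind (¬ Hit t U (src S S') D (k + 1 + 1)) = 0 := by
              intro t
              apply ind_false
              rw [not_not]
              exact ⟨1, by omega, s, hsD, .src_pay 0 s hsU (Or.inl ⟨rfl, hsS⟩)⟩
            unfold FF
            simp only [h0]
            exact EE_const p U 0
          rw [this]
          exact mul_nonneg (pow_nonneg hq _) (FF_nonneg hp _ _ _ _ _)
        · obtain ⟨V, hsV, rfl⟩ : ∃ V, s ∉ V ∧ U = insert s V :=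
            ⟨U.erase s, Finset.notMem_erase s U, (Finset.insert_erase hsU).symm⟩
          rw [Finset.card_insert_of_notMem hsV] at hU
          have hV : V.card = m := by omega
          have hp1 : 0 ≤ 1 - p := by linarith [hp.2]
          have hinv' : FF p D 1 V (S ∪ S' ∪ nb s) ∅ ≤ q := by
            have h1 := GG_step hp D V s hsV hsD (S ∪ S')
            have h2 : FF p D 1 V (S ∪ S' ∪ nb s) ∅ ≤ FF p D 1 V (S ∪ S') ∅ :=
              GG_antitone hp D V _ _ fun x _ hx => Or.inl hx
            have h3 := mul_le_mul_of_nonneg_left h2 hp1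
            linarith
          have a1 := ihm V hV S (S' ∪ nb s) (by rwa [← Set.union_assoc])
          have a2 := ihm V hV (S ∪ nb s) S' (by rwa [Set.union_right_comm])
          have a3 := FF_step hp D V s hsV S S' hsS (k + 1 + 1)
          have a4 := mul_le_mul_of_nonneg_left (GG_step hp D V s hsV hsD S)
            (pow_nonneg hq (k + 1))
          have a5 := mul_le_mul_of_nonneg_left a1 hp1
          have a6 := mul_le_mul_of_nonneg_left a2 hp.1
          nlinarith
      · push Not at hS
        have h1 : FF p D 1 U S ∅ = 1 := by
          have h0 : ∀ t, ind (¬ Hit t U (src S ∅) D 1) = 1 := by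
            intro t
            apply ind_true
            rintro ⟨j, hj, z, hz, hR⟩
            clear hz hj
            induction hR with
            | src_free j x hU _ h =>
              rcases h with ⟨_, h⟩ | ⟨_, h⟩
              · exact hS _ hU h
              · exact h
            | src_pay j x hU h =>
              rcases h with ⟨_, h⟩ | ⟨_, h⟩
              · exact hS _ hU h
              · exact h
            | free _ _ _ _ _ _ _ ih => exact ih
            | pay _ _ _ _ _ _ ih => exact ih
          unfold FF
          simp only [h0]
          exact EE_const p U 1
        have h2 : FF p D 1 U (S' ∪ ∅) ∅ ≤ q := by
          refine le_trans (GG_antitone hp D U _ _ ?_) hinv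
          rintro x hx (h | h)
          · exact absurd h (hS x hx)
          · exact Or.inl h
        have h3 := ihk _ U rfl S' ∅ h2
        rw [Set.union_empty] at h2
        rw [h1, mul_one]
        have h4 : FF p D (k + 1 + 1) U S S' ≤ FF p D (k + 1) U S' ∅ := by
          apply FF_shift hp D (k + 1) 1
          rintro j s hs (⟨rfl, h1⟩ | ⟨rfl, h1⟩)
          · exact Or.inr ⟨rfl, h1⟩
          · exact h1.elim
        calc _ ≤ _ := h4
          _ ≤ _ := h3
          _ ≤ q ^ k * q := mul_le_mul_of_nonneg_left h2 (pow_nonneg hq _)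
          _ = q ^ (k + 1) := (pow_succ _ _).symm

/-! ### The box and its symmetries -/

/-- The box as a finset. -/
def bx (n : ℕ) : Finset Site := Fintype.piFinset fun _ => Finset.Icc (-(n : ℤ)) n

lemma mem_bx {n : ℕ} {z : Site} : z ∈ bx n ↔ ∀ i, -(n : ℤ) ≤ z i ∧ z i ≤ n := by
  simp [bx]

lemma mem_box_iff {n : ℕ} {z : Site} : z ∈ box n ↔ z ∈ bx n := by
  rw [mem_bx]
  unfold box
  simp only [Set.mem_setOf_eq]
  refine forall_congr' fun i => ?_
  rw [abs_le]
  constructor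
  · rintro ⟨h1, h2⟩
    exact ⟨by exact_mod_cast h1, by exact_mod_cast h2⟩
  · rintro ⟨h1, h2⟩
    exact ⟨by exact_mod_cast h1, by exact_mod_cast h2⟩

/-- quarter faces, indexed by direction and signs. -/
def face (n : ℕ) (a : Fin 3 × (Fin 3 → ℤˣ)) : Set Site :=
  {z | z ∈ bx n ∧ (a.2 a.1 : ℤ) * z a.1 = n ∧ ∀ i, 0 ≤ (a.2 i : ℤ) * z i}

/-- the symmetry -/
def sym (a : Fin 3 × (Fin 3 → ℤˣ)) (z : Site) : Site :=
  fun i => (a.2 (Equiv.swap 0 a.1 i) : ℤ) * z (Equiv.swap 0 a.1 i)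

lemma sym_inj (a) : Function.Injective (sym a) := by
  intro x y h
  funext i
  have := congrFun h (Equiv.swap 0 a.1 i)
  simp only [sym, Equiv.swap_apply_self] at this
  exact mul_left_cancel₀ (Units.ne_zero _) this

lemma unit_abs (u : ℤˣ) (x : ℤ) : |(u : ℤ) * x| = |x| := by
  rcases Int.units_eq_one_or u with rfl | rfl <;> simp

lemma sym_adj (a) {x y : Site} (h : Adj x y) : Adj (sym a x) (sym a y) := by
  unfold Adj at *
  rw [← h, ← Equiv.sum_comp (Equiv.swap 0 a.1) (fun i => |x i - y i|)]
  apply Finset.sum_congr rfl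
  intro i _
  simp only [sym]
  rw [← mul_sub, unit_abs]

lemma mem_bx_abs {n : ℕ} {z : Site} : z ∈ bx n ↔ ∀ i, |z i| ≤ n := by
  rw [mem_bx]; simp only [abs_le]

lemma sym_bx (a) {n : ℕ} {z : Site} (h : z ∈ bx n) : sym a z ∈ bx n := by
  rw [mem_bx_abs] at *
  intro i
  simp only [sym, unit_abs]
  exact h _

lemma sym_map_bx (a) (n : ℕ) : (bx n).map ⟨sym a, sym_inj a⟩ = bx n := by
  apply Finset.eq_of_subset_of_card_le
  · intro z hz
    obtain ⟨y, hy, rfl⟩ := Finset.mem_map.1 hz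
    exact sym_bx a hy
  · rw [Finset.card_map]

lemma sym_face (a) {n : ℕ} {z : Site} (h : z ∈ face n a) : sym a z ∈ face n (0, 1) := by
  obtain ⟨h1, h2, h3⟩ := h
  refine ⟨sym_bx a h1, ?_, ?_⟩
  · simpa [sym] using h2
  · intro i
    simpa [sym] using h3 _

lemma sym_zero (a) : sym a 0 = 0 := by
  funext i; simp [sym]

lemma RR_sym (a) {n : ℕ} {t j z} (h : RR t (bx n) (src {0} ∅) j z) :
    RR (t.map ⟨sym a, sym_inj a⟩) (bx n) (src {0} ∅) j (sym a z) := by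
  have hs : ∀ j s, src {0} ∅ j s → src {0} ∅ j (sym a s) := by
    rintro j s (⟨rfl, h⟩ | ⟨rfl, h⟩)
    · left
      rw [Set.mem_singleton_iff] at h
      subst h
      exact ⟨rfl, sym_zero a⟩
    · exact h.elim
  have ht : ∀ s, s ∈ t → sym a s ∈ t.map ⟨sym a, sym_inj a⟩ := fun s hs =>
    Finset.mem_map.2 ⟨s, hs, rfl⟩
  induction h with
  | src_free j s hU h' h => exact .src_free _ _ (sym_bx a hU) (ht _ h') (hs _ _ h)
  | src_pay j s hU h => exact .src_pay _ _ (sym_bx a hU) (hs _ _ h)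
  | free j y s hU h' ha _ ih => exact .free _ _ _ (sym_bx a hU) (ht _ h') (sym_adj a ha) ih
  | pay j y s hU ha _ ih => exact .pay _ _ _ (sym_bx a hU) (sym_adj a ha) ih

lemma EE_sym (p : ℝ) (a) (n : ℕ) (f : Finset Site → ℝ) :
    EE p (bx n) (fun t => f (t.map ⟨sym a, sym_inj a⟩)) = EE p (bx n) f := by
  unfold EE
  have hpow : (bx n).powerset.map (Finset.mapEmbedding ⟨sym a, sym_inj a⟩).toEmbedding
      = (bx n).powerset := by
    apply Finset.eq_of_subset_of_card_le
    · intro t ht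
      obtain ⟨u, hu, rfl⟩ := Finset.mem_map.1 ht
      rw [Finset.mem_powerset] at *
      conv_rhs => rw [← sym_map_bx a n]
      exact Finset.map_subset_map.2 hu
    · rw [Finset.card_map]
  conv_rhs => rw [← hpow, Finset.sum_map]
  apply Finset.sum_congr rfl
  intro t _
  congr 1
  unfold wt
  conv_rhs => rw [← sym_map_bx a n, Finset.prod_map]
  apply Finset.prod_congr rfl
  intro z _
  have : (⟨sym a, sym_inj a⟩ : Site ↪ Site) z ∈ t.map ⟨sym a, sym_inj a⟩ ↔ z ∈ t :=
    Finset.mem_map' _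
  simp only [RelEmbedding.coe_toEmbedding, Finset.mapEmbedding_apply, this]

lemma FF_face {p : ℝ} (hp : p ∈ Set.Icc (0 : ℝ) 1) (n k : ℕ) (a) :
    FF p (face n (0, 1)) k (bx n) {0} ∅ ≤ FF p (face n a) k (bx n) {0} ∅ := by
  unfold FF
  rw [← EE_sym p a]
  apply EE_mono hp
  intro t _
  apply ind_mono
  rintro hn ⟨j, hj, z, hz, hR⟩
  exact hn ⟨j, hj, _, sym_face a hz, RR_sym a hR⟩

lemma FF_pow {p : ℝ} (hp : p ∈ Set.Icc (0 : ℝ) 1) (n k : ℕ) :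
    FF p (face n (0, 1)) k (bx n) {0} ∅ ^ 24 ≤ FF p (⋃ a, face n a) k (bx n) {0} ∅ := by
  have hcard : (Finset.univ : Finset (Fin 3 × (Fin 3 → ℤˣ))).card = 24 := by
    rw [Finset.card_univ]; simp
  have h1 : FF p (face n (0, 1)) k (bx n) {0} ∅ ^ 24 ≤
      ∏ a : Fin 3 × (Fin 3 → ℤˣ), FF p (face n a) k (bx n) {0} ∅ := by
    rw [← hcard, ← Finset.prod_const]
    exact Finset.prod_le_prod (fun _ _ => FF_nonneg hp _ _ _ _ _) fun a _ => FF_face hp n k a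
  refine h1.trans ?_
  unfold FF
  refine (harris_prod hp (bx n) Finset.univ
    (fun a t => ind (¬ Hit t (bx n) (src {0} ∅) (face n a) k)) ?_ ?_).trans ?_
  · intro a t t' htt
    apply ind_mono
    rintro hn ⟨j, hj, z, hz, hR⟩
    exact hn ⟨j, hj, z, hz, hR.mono (c := 0) htt fun _ _ _ h => h⟩
  · intro a t
    exact ind_nonneg _
  · apply EE_mono hp
    intro t _
    by_cases h : Hit t (bx n) (src {0} ∅) (⋃ a, face n a) k
    · obtain ⟨j, hj, z, hz, hR⟩ := h
      obtain ⟨a, ha⟩ := Set.mem_iUnion.1 hz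
      rw [Finset.prod_eq_zero (Finset.mem_univ a)]
      · exact ind_nonneg _
      · apply ind_false
        rw [not_not]
        exact ⟨j, hj, z, ha, hR⟩
    · rw [ind_true h]
      exact Finset.prod_le_one (fun _ _ => ind_nonneg _) fun _ _ => ind_le_one _

/-! ### Bridging with the paths -/

lemma RR_path {ω : Config} {n : ℕ} {j : ℕ} {z : Site}
    (h : RR ((bx n).filter fun z => ω z = true) (bx n) (src {0} ∅) j z) :
    ∃ γ, IsPathIn (box n) 0 z γ ∧ pathCost ω γ ≤ j := by
  have hsrc : ∀ j s, src {0} ∅ j s → s = 0 := by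
    rintro j s (⟨rfl, h⟩ | ⟨rfl, h⟩)
    · exact h
    · exact h.elim
  have ext : ∀ y s γ, s ∈ bx n → Adj y s → IsPathIn (box n) 0 y γ →
      IsPathIn (box n) 0 s (γ ++ [s]) := by
    rintro y s γ hs ha ⟨h1, h2, h3, h4⟩
    refine ⟨?_, ?_, ?_, ?_⟩
    · apply List.IsChain.append h1 (List.isChain_singleton s)
      intro x hx y' hy
      rw [h3] at hx
      simp at hx hy
      subst hx hy
      exact ha
    · simp [h2]
    · simp
    · intro x hx
      rcases List.mem_append.1 hx with h | h
      · exact h4 x h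
      · rw [List.mem_singleton] at h
        subst h
        exact mem_box_iff.2 hs
  have single : ∀ s : Site, s = 0 → s ∈ bx n → IsPathIn (box n) 0 s [s] := by
    rintro s rfl hs
    refine ⟨List.isChain_singleton _, rfl, rfl, ?_⟩
    intro x hx
    rw [List.mem_singleton] at hx
    subst hx
    exact mem_box_iff.2 hs
  induction h with
  | src_free j s hU h' h =>
    refine ⟨[s], single s (hsrc _ _ h) hU, ?_⟩
    simp [pathCost, (Finset.mem_filter.1 h').2]
  | src_pay j s hU h =>
    refine ⟨[s], single s (hsrc _ _ h) hU, ?_⟩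
    refine List.countP_le_length.trans ?_
    simp
  | free j y s hU h' ha _ ih =>
    obtain ⟨γ, h1, h2⟩ := ih
    refine ⟨γ ++ [s], ext y s γ hU ha h1, ?_⟩
    unfold pathCost at *
    rw [List.countP_append]
    simpa [(Finset.mem_filter.1 h').2] using h2
  | pay j y s hU ha _ ih =>
    obtain ⟨γ, h1, h2⟩ := ih
    refine ⟨γ ++ [s], ext y s γ hU ha h1, ?_⟩
    unfold pathCost at *
    rw [List.countP_append]
    have : List.countP (fun z => !ω z) [s] ≤ 1 := List.countP_le_length
    omega

lemma not_hit_of_travel {ω : Config} {n k : ℕ}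
    (h : (k : ℝ≥0∞) ≤ travelTimeSet ω (box n) 0 (faceSq n 0 true true true)) :
    ¬ Hit ((bx n).filter fun z => ω z = true) (bx n) (src {0} ∅) (face n (0, 1)) k := by
  rintro ⟨j, hj, z, hz, hR⟩
  obtain ⟨γ, h1, h2⟩ := RR_path hR
  have hz' : z ∈ faceSq n 0 true true true := by
    obtain ⟨a, b, c⟩ := hz
    refine ⟨mem_box_iff.2 a, ?_, ?_, ?_⟩
    · simpa using b
    · simpa using c (others 0).1
    · simpa using c (others 0).2
  have h3 : travelTimeSet ω (box n) 0 (faceSq n 0 true true true) ≤ (pathCost ω γ : ℝ≥0∞) := by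
    unfold travelTimeSet
    refine (iInf₂_le z hz').trans ?_
    exact sInf_le ⟨γ, h1, rfl⟩
  have h4 := h.trans h3
  have h5 : k ≤ pathCost ω γ := by exact_mod_cast h4
  omega

lemma exit_face {n : ℕ} {y s : Site} (hy : y ∈ bx n) (hs : s ∉ bx n) (ha : Adj y s) :
    y ∈ ⋃ a, face n a := by
  rw [mem_bx_abs] at hs
  push Not at hs
  obtain ⟨d, hd⟩ := hs
  have h1 : |y d - s d| ≤ 1 := by
    unfold Adj at ha
    rw [← ha]
    exact Finset.single_le_sum (f := fun i => |y i - s i|) (fun i _ => abs_nonneg _)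
      (Finset.mem_univ d)
  have h2 := mem_bx_abs.1 hy d
  have h3 : |y d| = n := by
    have := abs_sub_abs_le_abs_sub (s d) (y d)
    rw [abs_sub_comm] at this
    omega
  refine Set.mem_iUnion.2 ⟨(d, fun i => if 0 ≤ y i then 1 else -1), hy, ?_, ?_⟩
  · rw [← h3]
    dsimp only
    split_ifs with h
    · simp [abs_of_nonneg h]
    · simp [abs_of_neg (not_le.1 h)]
  · intro i
    dsimp only
    split_ifs with h
    · simpa using h
    · simp; omega

lemma path_hit {ω : Config} {n : ℕ} (γ : List Site) :
    ∀ y, IsPathIn {z | ω z = true} 0 y γ →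
    RR ((bx n).filter fun z => ω z = true) (bx n) (src {0} ∅) 0 y ∨
    Hit ((bx n).filter fun z => ω z = true) (bx n) (src {0} ∅) (⋃ a, face n a) 1 := by
  induction γ using List.reverseRecOn with
  | nil => rintro y ⟨_, h, _⟩; simp at h
  | append_singleton γ s ih =>
    rintro y ⟨h1, h2, h3, h4⟩
    simp at h3
    subst h3
    have hs : ω s = true := h4 s (by simp)
    rcases List.eq_nil_or_concat γ with rfl | ⟨γ', x, rfl⟩
    · simp at h2
      subst h2
      left
      have : (0 : Site) ∈ bx n := by rw [mem_bx]; simp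
      exact .src_free _ _ this (Finset.mem_filter.2 ⟨this, hs⟩) (Or.inl ⟨rfl, rfl⟩)
    · have hx := ih x ⟨(List.isChain_append.1 h1).1, by simpa using h2, by simp,
        fun z hz => h4 z (List.mem_append_left _ hz)⟩
      have ha : Adj x s := (List.isChain_append.1 h1).2.2 x (by simp) s (by simp)
      rcases hx with hx | hx
      · by_cases hsb : s ∈ bx n
        · left
          exact .free _ x _ hsb (Finset.mem_filter.2 ⟨hsb, hs⟩) ha hx
        · right
          exact ⟨0, by omega, x, exit_face hx.mem hsb ha, hx⟩
      · exact Or.inr hx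

lemma infinite_hit {ω : Config} {n : ℕ} (h : (cluster ω 0).Infinite) :
    Hit ((bx n).filter fun z => ω z = true) (bx n) (src {0} ∅) (⋃ a, face n a) 1 := by
  obtain ⟨y, hy, hyb⟩ := h.exists_notMem_finset (bx n)
  obtain ⟨γ, hγ⟩ := hy
  rcases path_hit (n := n) γ y hγ with h | h
  · exact absurd h.mem hyb
  · exact h

lemma EE_compl (p : ℝ) (U : Finset Site) (A : Finset Site → Prop) :
    EE p U (fun t => ind (A t)) = 1 - EE p U (fun t => ind (¬ A t)) := by
  have h : EE p U (fun t => ind (A t)) + EE p U (fun t => ind (¬ A t)) = 1 := by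
    rw [← EE_const p U 1]
    unfold EE
    rw [← Finset.sum_add_distrib]
    apply Finset.sum_congr rfl
    intro t _
    rw [← mul_add]
    congr 1
    dsimp only
    by_cases h : A t
    · rw [ind_true h, ind_false (not_not.2 h)]; norm_num
    · rw [ind_true h, ind_false h]; norm_num
  linarith

/-- `P(T_Λ(0, F_1^1) ≥ k) ≤ (1 - θ(p))^{k/24}`. -/
theorem stmt_5 (p : ℝ) (hp : p ∈ Set.Icc (0 : ℝ) 1)
    (P : Measure Config) [IsProbabilityMeasure P] (hP : IsBernoulli p P)
    (hθ : 0 < theta P) (n : ℕ) (hn : 1 ≤ n) (k : ℕ) (hk : 1 ≤ k) :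
    P {ω | (k : ℝ≥0∞) ≤ travelTimeSet ω (box n) 0 (faceSq n 0 true true true)} ≤
      (1 - theta P) ^ ((k : ℝ) / 24) := by
  set q := FF p (⋃ a, face n a) 1 (bx n) {0} ∅ with hqdef
  set x := FF p (face n (0, 1)) k (bx n) {0} ∅ with hxdef
  have hq0 : 0 ≤ q := FF_nonneg hp _ _ _ _ _
  have hx0 : 0 ≤ x := FF_nonneg hp _ _ _ _ _
  have hPx : P {ω | (k : ℝ≥0∞) ≤ travelTimeSet ω (box n) 0 (faceSq n 0 true true true)}
      ≤ ENNReal.ofReal x :=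
    (measure_mono fun ω hω => not_hit_of_travel hω).trans
      (P_le_EE hp P hP (bx n) fun t => ¬ Hit t (bx n) (src {0} ∅) (face n (0, 1)) k)
  have hxq : x ^ 24 ≤ q ^ k := by
    obtain ⟨m, rfl⟩ : ∃ m, k = m + 1 := ⟨k - 1, by omega⟩
    refine (FF_pow hp n (m + 1)).trans ?_
    have := explore hp (⋃ a, face n a) q hq0 m _ (bx n) rfl {0} ∅
      (by rw [Set.union_empty])
    rwa [← hqdef, ← pow_succ] at this
  have hθq : theta P ≤ ENNReal.ofReal (1 - q) := by
    have h1 : theta P ≤ _ := (measure_mono fun ω hω => infinite_hit (n := n) hω).trans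
      (P_le_EE hp P hP (bx n) fun t => Hit t (bx n) (src {0} ∅) (⋃ a, face n a) 1)
    rwa [EE_compl] at h1
  have hq1 : ENNReal.ofReal q ≤ 1 - theta P := by
    have hle : q ≤ 1 := by
      rw [← EE_const p (bx n) 1]
      exact EE_mono hp _ fun _ _ => ind_le_one _
    refine le_trans ?_ (tsub_le_tsub_left hθq 1)
    rw [← ENNReal.ofReal_one, ← ENNReal.ofReal_sub 1 (by linarith)]
    apply ENNReal.ofReal_le_ofReal
    linarith
  refine hPx.trans ?_
  have h24 : ENNReal.ofReal x ^ 24 ≤ (1 - theta P) ^ k := by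
    calc ENNReal.ofReal x ^ 24 = ENNReal.ofReal (x ^ 24) := (ENNReal.ofReal_pow hx0 24).symm
      _ ≤ ENNReal.ofReal (q ^ k) := ENNReal.ofReal_le_ofReal hxq
      _ = ENNReal.ofReal q ^ k := ENNReal.ofReal_pow hq0 k
      _ ≤ _ := by gcongr
  have h := ENNReal.rpow_le_rpow h24 (z := 1 / 24) (by norm_num)
  rw [← ENNReal.rpow_natCast, ← ENNReal.rpow_natCast, ← ENNReal.rpow_mul, ← ENNReal.rpow_mul] at h
  norm_num at h
  rwa [div_eq_mul_inv, ← one_div]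
end
end
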